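/- Let τ be a conformal transformation of 𝕊² with center of mass a = a_τ, let u: 𝕊² → ℝ be measurable with ∫_{𝕊²} e^{2u} dω < ∞, and set u_τ = u∘τ + ψ_τ. Then ∫_{𝕊²} e^{2u_τ} dω = ∫_{𝕊²} ((1 − |a|²)/(1 − a·τ^{−1}(ω))) e^{2u} dω, and ∫_{𝕊²} ω e^{2u_τ} dω = ∫_{𝕊²} τ^{−1}(ω)·((1 − |a|²)/(1 − a·τ^{−1}(ω))) e^{2u} dω. -/

import Mathlib

open MeasureTheory
open scoped Classical

noncomputable section

/-- Squared Euclidean norm on `ℝ²`. -/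
def sq2 (x : ℝ × ℝ) : ℝ := x.1 ^ 2 + x.2 ^ 2

/-- Euclidean dot product on `ℝ³`. -/
def dot3 (a b : Fin 3 → ℝ) : ℝ := a 0 * b 0 + a 1 * b 1 + a 2 * b 2

/-- Squared Euclidean norm on `ℝ³`. -/
def norm3sq (a : Fin 3 → ℝ) : ℝ := dot3 a a

/-- Stereographic projection from the north pole. -/
def SP (ω : Fin 3 → ℝ) : ℝ × ℝ := (ω 0 / (1 - ω 2), ω 1 / (1 - ω 2))

/-- Inverse stereographic projection. -/
def SPinv (x : ℝ × ℝ) : Fin 3 → ℝ :=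
  ![2 * x.1 / (1 + sq2 x), 2 * x.2 / (1 + sq2 x), (sq2 x - 1) / (1 + sq2 x)]

/-- Identification `ℝ² ≅ ℂ`. -/
def cx (x : ℝ × ℝ) : ℂ := ⟨x.1, x.2⟩

/-- Identification `ℂ ≅ ℝ²`. -/
def uncx (z : ℂ) : ℝ × ℝ := (z.re, z.im)

/-- The group `SL(2,ℂ)`. -/
abbrev SL2C := Matrix.SpecialLinearGroup (Fin 2) ℂ

/-- The Möbius transformation associated to `A ∈ SL(2,ℂ)`. -/
def TA (A : SL2C) (z : ℂ) : ℂ := (A.1 0 0 * z + A.1 0 1) / (A.1 1 0 * z + A.1 1 1)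

/-- The north pole of `𝕊²`. -/
def northPole : Fin 3 → ℝ := ![0, 0, 1]

/-- The conformal transformation of `𝕊²` induced by `A ∈ SL(2,ℂ)` via stereographic
projection, extended continuously over the poles. -/
def tauA (A : SL2C) (ω : Fin 3 → ℝ) : Fin 3 → ℝ :=
  if ω 2 = 1 then
    if A.1 1 0 = 0 then northPole else SPinv (uncx (A.1 0 0 / A.1 1 0))
  else if A.1 1 0 * cx (SP ω) + A.1 1 1 = 0 then northPole
  else SPinv (uncx (TA A (cx (SP ω))))

/-- The Jacobian `𝒥_{τ_A}(ω) = ((1+|z|²)/(|az+b|²+|cz+d|²))²`, `z = 𝒮(ω)`,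
extended continuously over the north pole. -/
def jacA (A : SL2C) (ω : Fin 3 → ℝ) : ℝ :=
  if ω 2 = 1 then (1 / (Complex.normSq (A.1 0 0) + Complex.normSq (A.1 1 0))) ^ 2
  else
    ((1 + Complex.normSq (cx (SP ω))) /
        (Complex.normSq (A.1 0 0 * cx (SP ω) + A.1 0 1) +
          Complex.normSq (A.1 1 0 * cx (SP ω) + A.1 1 1))) ^ 2

/-- `∫_{𝕊²} f dω = (1/π) ∫_{ℝ²} f(𝒮⁻¹(x)) (1+|x|²)⁻² dx`, the integral against the
normalized surface measure of `𝕊²`, written in stereographic coordinates. -/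
def sphInt {E : Type*} [NormedAddCommGroup E] [NormedSpace ℝ E]
    (f : (Fin 3 → ℝ) → E) : E :=
  (1 / Real.pi) • ∫ x : ℝ × ℝ, ((1 + sq2 x)⁻¹) ^ 2 • f (SPinv x)

/-- Integrability of `f : 𝕊² → ℝ` with respect to the normalized surface measure,
expressed in stereographic coordinates. -/
def SphIntegrable (f : (Fin 3 → ℝ) → ℝ) : Prop :=
  Integrable fun x : ℝ × ℝ => ((1 + sq2 x)⁻¹) ^ 2 * f (SPinv x)

/-- The mass `M_τ = ∫_{𝕊²} 𝒥_τ^{3/2} dω`. -/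
def massA (A : SL2C) : ℝ := sphInt fun ω => jacA A ω ^ (3 / 2 : ℝ)

/-- The center of mass `a_τ = M_τ⁻¹ ∫_{𝕊²} ω 𝒥_τ^{3/2}(ω) dω`. -/
def comA (A : SL2C) : Fin 3 → ℝ :=
  (massA A)⁻¹ • sphInt fun ω => jacA A ω ^ (3 / 2 : ℝ) • ω

/-- The normalizing constant `c_τ = -(1/2) ln M_τ`. -/
def cA (A : SL2C) : ℝ := -(1 / 2) * Real.log (massA A)

/-- `ψ_τ = (3/4) ln 𝒥_τ + c_τ`. -/
def psiA (A : SL2C) (ω : Fin 3 → ℝ) : ℝ := (3 / 4) * Real.log (jacA A ω) + cA A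

/-- `|∇v(x)|²` for `v : ℝ² → ℝ`. -/
def gradSq (v : ℝ × ℝ → ℝ) (x : ℝ × ℝ) : ℝ :=
  fderiv ℝ v x (1, 0) ^ 2 + fderiv ℝ v x (0, 1) ^ 2

/-- The Dirichlet energy `∫_{𝕊²} |∇_{𝕊²} u|² dω = (1/(4π)) ∫_{ℝ²} |∇(u∘𝒮⁻¹)(x)|² dx`. -/
def gradTerm (u : (Fin 3 → ℝ) → ℝ) : ℝ :=
  (1 / (4 * Real.pi)) * ∫ x : ℝ × ℝ, gradSq (fun y => u (SPinv y)) x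

/-- Membership in the Sobolev space `H¹(𝕊²)`. -/
def MemH1 (u : (Fin 3 → ℝ) → ℝ) : Prop :=
  SphIntegrable u ∧ SphIntegrable (fun ω => u ω ^ 2) ∧
    Integrable fun x : ℝ × ℝ => gradSq (fun y => u (SPinv y)) x

/-- The Chang–Gui functional `I_α`. -/
def CG (α : ℝ) (u : (Fin 3 → ℝ) → ℝ) : ℝ :=
  α * gradTerm u + 2 * sphInt u -
    (1 / 2) * Real.log
      ((sphInt fun ω => Real.exp (2 * u ω)) ^ 2 -
        norm3sq (sphInt fun ω => Real.exp (2 * u ω) • ω))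

end

lemma auxZeros (a c d : ℂ) (b : ℂ) (h : a * d - b * c = 1) :
    volume {z : ℂ | c * z + d ≠ 0}ᶜ = 0 := by
  apply Set.Countable.measure_zero
  apply Set.Subsingleton.countable
  intro x hx y hy
  simp only [ne_eq, Set.mem_compl_iff, Set.mem_ofPred_eq, not_not] at hx hy
  by_cases hc : c = 0
  · subst hc
    simp at hx
    subst hx
    simp at h
  · have : c * (x - y) = 0 := by linear_combination hx - hy
    rcases mul_eq_zero.mp this with h | h
    · exact absurd h hc
    · exact sub_eq_zero.mp h

lemma auxDet (w : ℂ) : (ContinuousLinearMap.restrictScalars ℝ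
    (ContinuousLinearMap.toSpanSingleton ℂ w)).det = Complex.normSq w := by
  rw [← Algebra.norm_complex_apply, Algebra.norm_apply, ContinuousLinearMap.det]
  congr 1
  ext
  simp [mul_comm]

lemma changeVar {E : Type*} [NormedAddCommGroup E] [NormedSpace ℝ E]
    (a b c d : ℂ) (h : a * d - b * c = 1) (G : ℂ → E) :
    ∫ y : ℂ, ((1 + Complex.normSq y)⁻¹) ^ 2 • G y =
    ∫ z : ℂ, ((Complex.normSq (a * z + b) + Complex.normSq (c * z + d))⁻¹) ^ 2 •
      G ((a * z + b) / (c * z + d)) := by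
  set S : Set ℂ := {z : ℂ | c * z + d ≠ 0} with hS
  have hSm : MeasurableSet S := by
    apply IsOpen.measurableSet
    exact isOpen_ne_fun (by fun_prop) (by fun_prop)
  have hS0 : volume Sᶜ = 0 := auxZeros a c d b h
  have hIm : (fun z => (a * z + b) / (c * z + d)) '' S = {z : ℂ | -c * z + a ≠ 0} := by
    ext w
    constructor
    · rintro ⟨z, hz, rfl⟩
      simp only [Set.mem_ofPred_eq, hS] at hz ⊢
      have : -c * ((a * z + b) / (c * z + d)) + a = 1 / (c * z + d) := by
        field_simp
        linear_combination h
      simp only [this]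
      exact one_div_ne_zero hz
    · intro hw
      simp only [Set.mem_ofPred_eq] at hw
      have hw : a - c * w ≠ 0 := fun h => hw (by linear_combination h)
      have e : c * ((d * w - b) / (a - c * w)) + d = 1 / (a - c * w) := by
        field_simp
        linear_combination h
      refine ⟨(d * w - b) / (a - c * w), ?_, ?_⟩
      · simp only [hS, Set.mem_ofPred_eq, e]
        exact one_div_ne_zero hw
      · have e2 : a * ((d * w - b) / (a - c * w)) + b = w / (a - c * w) := by
          rw [← mul_div_assoc, div_add' _ _ _ hw, div_left_inj' hw]
          linear_combination w * h
        simp only [e, e2]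
        rw [div_div_div_cancel_right₀ hw, div_one]
  have hIm0 : volume ((fun z => (a * z + b) / (c * z + d)) '' S)ᶜ = 0 := by
    rw [hIm]
    exact auxZeros d (-c) a (-b) (by linear_combination h)
  have hder : ∀ z ∈ S, HasFDerivWithinAt (fun z => (a * z + b) / (c * z + d))
      (ContinuousLinearMap.restrictScalars ℝ
        (ContinuousLinearMap.toSpanSingleton ℂ (1 / (c * z + d) ^ 2))) S z := by
    intro z hz
    have h1 : HasDerivAt (fun z => a * z + b) a z := by
      simpa using ((hasDerivAt_id z).const_mul a).add_const b
    have h2 : HasDerivAt (fun z => c * z + d) c z := by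
      simpa using ((hasDerivAt_id z).const_mul c).add_const d
    have h3 := h1.div h2 hz
    have e : (a * (c * z + d) - (a * z + b) * c) / (c * z + d) ^ 2 = 1 / (c * z + d) ^ 2 := by
      congr 1
      linear_combination h
    rw [e] at h3
    exact (h3.hasFDerivAt.restrictScalars ℝ).hasFDerivWithinAt
  have hinj : Set.InjOn (fun z => (a * z + b) / (c * z + d)) S := by
    intro z hz w hw e
    simp only [hS, Set.mem_ofPred_eq] at hz hw
    simp only at e
    rw [div_eq_div_iff hz hw] at e
    linear_combination e - (z - w) * h
  have key := integral_image_eq_integral_abs_det_fderiv_smul volume hSm hder hinj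
    (fun y => ((1 + Complex.normSq y)⁻¹) ^ 2 • G y)
  rw [Measure.restrict_eq_self_of_ae_mem (s := _ '' S) (by exact hIm0)] at key
  rw [key, ← Measure.restrict_eq_self_of_ae_mem (s := S) (μ := volume) (by exact hS0)]
  rw [Measure.restrict_restrict hSm, Set.inter_self]
  refine setIntegral_congr_fun hSm ?_
  intro z hz
  have hz' : Complex.normSq (c * z + d) ≠ 0 := by
    simpa [hS] using hz
  simp only [auxDet, smul_smul]
  congr 1
  rw [abs_of_nonneg (Complex.normSq_nonneg _)]
  simp only [map_div₀, map_pow, map_one]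
  have hp : 0 < Complex.normSq (c * z + d) :=
    lt_of_le_of_ne (Complex.normSq_nonneg _) (Ne.symm hz')
  have := Complex.normSq_nonneg (a * z + b)
  field_simp
  rw [add_comm]

lemma auxInt {n : ℕ} (hn : 2 ≤ n) :
    Integrable (fun z : ℂ => ((1 + Complex.normSq z)⁻¹) ^ n) := by
  have := integrable_rpow_neg_one_add_norm_sq (E := ℂ) (μ := volume) (r := 2 * n) (by
    have : (2:ℝ) ≤ n := by exact_mod_cast hn
    simp; linarith)
  refine this.congr (Filter.Eventually.of_forall fun z => ?_)
  have h0 : (0:ℝ) ≤ 1 + Complex.normSq z := by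
    have := Complex.normSq_nonneg z
    linarith
  simp only [← Complex.normSq_eq_norm_sq]
  rw [show -(2 * (n:ℝ)) / 2 = -(n:ℝ) by ring, Real.rpow_neg h0, Real.rpow_natCast, inv_pow]

lemma auxVal (n : ℕ) :
    ∫ z : ℂ, ((1 + Complex.normSq z)⁻¹) ^ (n + 2) = Real.pi / (n + 1) := by
  have h1 := integral_fun_norm_addHaar (E := ℂ) volume (fun r : ℝ => ((1 + r ^ 2)⁻¹) ^ (n + 2))
  simp only [← Complex.normSq_eq_norm_sq] at h1
  rw [h1]
  have hb : (volume : Measure ℂ).real (Metric.ball 0 1) = Real.pi := by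
    simp [Measure.real, Complex.volume_ball]
  rw [hb, Complex.finrank_real_complex]
  have h2 : ∫ y in Set.Ioi (0:ℝ), y ^ (2 - 1) • ((1 + y ^ 2)⁻¹) ^ (n + 2) =
      0 - (-(1 / (2 * ((n : ℝ) + 1))) * ((1 + (0:ℝ) ^ 2)⁻¹) ^ (n + 1)) := by
    apply integral_Ioi_of_hasDerivAt_of_nonneg'
      (g := fun y : ℝ => -(1 / (2 * ((n : ℝ) + 1))) * ((1 + y ^ 2)⁻¹) ^ (n + 1))
    · intro x _
      have hx : 1 + x ^ 2 ≠ 0 := by positivity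
      have := (((((hasDerivAt_id x).pow 2).const_add 1).inv hx).pow (n + 1)).const_mul
        (-(1 / (2 * ((n:ℝ) + 1))))
      convert! this using 1
      simp
      field_simp
      ring
    · intro x hx
      have : (0:ℝ) < x := hx
      simp only [smul_eq_mul]
      positivity
    · have t : Filter.Tendsto (fun y : ℝ => (1 + y ^ 2)⁻¹) Filter.atTop (nhds 0) := by
        apply Filter.Tendsto.inv_tendsto_atTop
        apply Filter.tendsto_atTop_add_const_left
        exact Filter.tendsto_pow_atTop (by norm_num)
      have := (t.pow (n + 1)).const_mul (-(1 / (2 * ((n:ℝ) + 1))))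
      simpa using this
  rw [h2]
  simp
  field_simp

lemma auxOdd (L : ℂ → ℝ) (hL : ∀ z, L (-z) = - L z) :
    ∫ z : ℂ, ((1 + Complex.normSq z)⁻¹) ^ 3 * L z = 0 := by
  have := integral_neg_eq_self (fun z : ℂ => ((1 + Complex.normSq z)⁻¹) ^ 3 * L z) volume
  simp only [Complex.normSq_neg, hL, mul_neg, integral_neg] at this
  linarith

lemma auxBound (L : ℂ → ℝ) (hc : Continuous L) (hL : ∀ z, |L z| ≤ 1 + Complex.normSq z) :
    Integrable fun z : ℂ => ((1 + Complex.normSq z)⁻¹) ^ 3 * L z := by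
  refine (auxInt (n := 2) le_rfl).mono' ?_ (Filter.Eventually.of_forall fun z => ?_)
  · apply Continuous.aestronglyMeasurable
    refine Continuous.mul (Continuous.pow (Continuous.inv₀ ?_ ?_) 3) hc
    · exact continuous_const.add Complex.continuous_normSq
    · intro z
      have := Complex.normSq_nonneg z
      positivity
  · have h0 := Complex.normSq_nonneg z
    rw [norm_mul, Real.norm_eq_abs, Real.norm_eq_abs, abs_of_nonneg (by positivity)]
    calc ((1 + Complex.normSq z)⁻¹) ^ 3 * |L z|
        ≤ ((1 + Complex.normSq z)⁻¹) ^ 3 * (1 + Complex.normSq z) := by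
          gcongr
          exact hL z
      _ = _ := by field_simp

lemma auxForm (p q r s : ℝ) :
    ∫ z : ℂ, ((1 + Complex.normSq z)⁻¹) ^ 3 *
      (p * Complex.normSq z + q + r * z.re + s * z.im) = Real.pi * (p + q) / 2 := by
  have i2 := auxInt (n := 2) le_rfl
  have i3 := auxInt (n := 3) (by norm_num)
  have ir := auxBound (fun z => z.re) Complex.continuous_re (fun z => by
    rw [Complex.normSq_apply, abs_le]
    constructor <;> nlinarith [sq_nonneg (z.re - 1), sq_nonneg (z.re + 1), sq_nonneg z.im])
  have ii := auxBound (fun z => z.im) Complex.continuous_im (fun z => by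
    rw [Complex.normSq_apply, abs_le]
    constructor <;> nlinarith [sq_nonneg (z.im - 1), sq_nonneg (z.im + 1), sq_nonneg z.re])
  have e : ∀ z : ℂ, ((1 + Complex.normSq z)⁻¹) ^ 3 *
      (p * Complex.normSq z + q + r * z.re + s * z.im) =
      p * ((1 + Complex.normSq z)⁻¹) ^ 2 + (q - p) * ((1 + Complex.normSq z)⁻¹) ^ 3
      + r * (((1 + Complex.normSq z)⁻¹) ^ 3 * z.re)
      + s * (((1 + Complex.normSq z)⁻¹) ^ 3 * z.im) := by
    intro z
    have h0 := Complex.normSq_nonneg z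
    field_simp
    ring
  simp only [e]
  have j1 : Integrable fun z : ℂ => p * ((1 + Complex.normSq z)⁻¹) ^ 2 +
      (q - p) * ((1 + Complex.normSq z)⁻¹) ^ 3 := (i2.const_mul p).add (i3.const_mul (q - p))
  have j2 : Integrable fun z : ℂ => p * ((1 + Complex.normSq z)⁻¹) ^ 2 +
      (q - p) * ((1 + Complex.normSq z)⁻¹) ^ 3 +
      r * (((1 + Complex.normSq z)⁻¹) ^ 3 * z.re) := j1.add (ir.const_mul r)
  rw [integral_add j2 (ii.const_mul s), integral_add j1 (ir.const_mul r),
    integral_add (i2.const_mul p) (i3.const_mul (q - p))]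
  simp only [integral_const_mul]
  rw [auxOdd (fun z => z.re) (by simp), auxOdd (fun z => z.im) (by simp)]
  have v2 := auxVal 0
  have v3 := auxVal 1
  norm_num at v2 v3
  simp only [inv_pow]
  rw [v2, v3]
  ring

lemma sphInt_eq {E : Type*} [NormedAddCommGroup E] [NormedSpace ℝ E]
    (f : (Fin 3 → ℝ) → E) : sphInt f =
      (1 / Real.pi) • ∫ z : ℂ, ((1 + Complex.normSq z)⁻¹) ^ 2 • f (SPinv (uncx z)) := by
  unfold sphInt
  rw [← Complex.volume_preserving_equiv_real_prod.integral_comp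
    Complex.measurableEquivRealProd.measurableEmbedding]
  simp only [Complex.measurableEquivRealProd_apply, sq2, uncx, Complex.normSq_apply, pow_two]

lemma SPinv_two (x : ℝ × ℝ) : SPinv x 2 ≠ 1 := by
  have h : 0 < 1 + sq2 x := by unfold sq2; positivity
  simp only [SPinv, Matrix.cons_val]
  rw [Ne, div_eq_iff h.ne']
  intro h'
  linarith

lemma SP_SPinv (z : ℂ) : cx (SP (SPinv (uncx z))) = z := by
  have h : 0 < 1 + sq2 (uncx z) := by unfold sq2; positivity
  have e : 1 - (sq2 (uncx z) - 1) / (1 + sq2 (uncx z)) = 2 / (1 + sq2 (uncx z)) := by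
    field_simp
    ring
  apply Complex.ext
  · simp only [cx, SP, SPinv, Matrix.cons_val, e]
    field_simp
    rfl
  · simp only [cx, SP, SPinv, Matrix.cons_val, e]
    field_simp
    rfl

lemma auxQpos (a b c d z : ℂ) (h : a * d - b * c = 1) :
    0 < Complex.normSq (a * z + b) + Complex.normSq (c * z + d) := by
  have h1 := Complex.normSq_nonneg (a * z + b)
  have h2 := Complex.normSq_nonneg (c * z + d)
  by_contra hn
  have e1 : a * z + b = 0 := Complex.normSq_eq_zero.mp (by linarith)
  have e2 : c * z + d = 0 := Complex.normSq_eq_zero.mp (by linarith)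
  have : (1 : ℂ) = 0 := by linear_combination -h + a * e2 - c * e1
  exact one_ne_zero this

lemma auxForm2 (a b c d : ℂ) (h : a * d - b * c = 1) (p q r s : ℝ) :
    ∫ z : ℂ, ((Complex.normSq (a * z + b) + Complex.normSq (c * z + d))⁻¹) ^ 3 *
      (p * Complex.normSq (a * z + b) + q * Complex.normSq (c * z + d)
        + r * ((a * z + b).re * (c * z + d).re + (a * z + b).im * (c * z + d).im)
        + s * ((a * z + b).im * (c * z + d).re - (a * z + b).re * (c * z + d).im))
      = Real.pi * (p + q) / 2 := by
  have key := changeVar a b c d h (fun y : ℂ => (1 + Complex.normSq y)⁻¹ *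
    (p * Complex.normSq y + q + r * y.re + s * y.im))
  rw [← auxForm p q r s]
  have e : ∀ y : ℂ, ((1 + Complex.normSq y)⁻¹) ^ 2 • ((1 + Complex.normSq y)⁻¹ *
    (p * Complex.normSq y + q + r * y.re + s * y.im)) = ((1 + Complex.normSq y)⁻¹) ^ 3 *
    (p * Complex.normSq y + q + r * y.re + s * y.im) := by
    intro y
    simp only [smul_eq_mul]
    ring
  simp only [e] at key
  rw [key]
  apply integral_congr_ae
  have hS0 : ∀ᵐ z : ℂ, c * z + d ≠ 0 := auxZeros a c d b h
  filter_upwards [hS0] with z hz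
  have hq := auxQpos a b c d z h
  generalize a * z + b = X at *
  generalize c * z + d = Y at *
  have hY : 0 < Complex.normSq Y := Complex.normSq_pos.mpr hz
  have hX := Complex.normSq_nonneg X
  simp only [smul_eq_mul, Complex.normSq_div, Complex.div_re, Complex.div_im]
  rw [pow_succ, mul_assoc]
  congr 1
  field_simp
  ring

lemma jac_eval (A : SL2C) (z : ℂ) : jacA A (SPinv (uncx z)) =
    ((1 + Complex.normSq z) / (Complex.normSq (A.1 0 0 * z + A.1 0 1) +
          Complex.normSq (A.1 1 0 * z + A.1 1 1))) ^ 2 := by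
  unfold jacA
  rw [if_neg (SPinv_two _), SP_SPinv]

lemma tau_eval (A : SL2C) (z : ℂ) (hz : A.1 1 0 * z + A.1 1 1 ≠ 0) :
    tauA A (SPinv (uncx z)) =
    SPinv (uncx ((A.1 0 0 * z + A.1 0 1) / (A.1 1 0 * z + A.1 1 1))) := by
  unfold tauA
  rw [if_neg (SPinv_two _), SP_SPinv, if_neg hz, TA]

lemma auxDetA (A : SL2C) : A.1 0 0 * A.1 1 1 - A.1 0 1 * A.1 1 0 = 1 := by
  rw [← Matrix.det_fin_two]
  exact A.2

lemma tau_inv_eval (A : SL2C) (z : ℂ) (hz : A.1 1 0 * z + A.1 1 1 ≠ 0) :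
    tauA A⁻¹ (SPinv (uncx ((A.1 0 0 * z + A.1 0 1) / (A.1 1 0 * z + A.1 1 1)))) =
      SPinv (uncx z) := by
  have h := auxDetA A
  have e00 : (A⁻¹).1 0 0 = A.1 1 1 := by rw [Matrix.SpecialLinearGroup.SL2_inv_expl]; simp
  have e01 : (A⁻¹).1 0 1 = -A.1 0 1 := by rw [Matrix.SpecialLinearGroup.SL2_inv_expl]; simp
  have e10 : (A⁻¹).1 1 0 = -A.1 1 0 := by rw [Matrix.SpecialLinearGroup.SL2_inv_expl]; simp
  have e11 : (A⁻¹).1 1 1 = A.1 0 0 := by rw [Matrix.SpecialLinearGroup.SL2_inv_expl]; simp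
  generalize A.1 0 0 = a at *
  generalize A.1 0 1 = b at *
  generalize A.1 1 0 = c at *
  generalize A.1 1 1 = d at *
  have k1 : -c * ((a * z + b) / (c * z + d)) + a = 1 / (c * z + d) := by
    field_simp
    linear_combination h
  have k2 : d * ((a * z + b) / (c * z + d)) + -b = z / (c * z + d) := by
    rw [← mul_div_assoc, div_add' _ _ _ hz, div_left_inj' hz]
    linear_combination z * h
  rw [tau_eval]
  · rw [e00, e01, e10, e11, k1, k2]
    rw [div_div_div_cancel_right₀ hz, div_one]
  · rw [e10, e11, k1]
    exact one_div_ne_zero hz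

lemma pow32 {t : ℝ} (ht : 0 < t) : (t ^ 2) ^ (3 / 2 : ℝ) = t ^ 3 := by
  rw [← Real.rpow_natCast t 2, ← Real.rpow_mul ht.le]
  norm_num

/-- the value of the mass -/
noncomputable def mVal (A : SL2C) : ℝ :=
  (Complex.normSq (A.1 0 0) + Complex.normSq (A.1 0 1) + Complex.normSq (A.1 1 0)
    + Complex.normSq (A.1 1 1)) / 2

lemma mVal_pos (A : SL2C) : 0 < mVal A := by
  have h := auxDetA A
  have h2 := auxQpos _ _ _ _ 0 h
  simp only [mul_zero, zero_add] at h2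
  have := Complex.normSq_nonneg (A.1 0 0)
  have := Complex.normSq_nonneg (A.1 1 0)
  unfold mVal
  linarith

lemma integrand_eq (A : SL2C) (z : ℂ) :
    ((1 + Complex.normSq z)⁻¹) ^ 2 * jacA A (SPinv (uncx z)) ^ (3 / 2 : ℝ) =
    ((Complex.normSq (A.1 0 0 * z + A.1 0 1) + Complex.normSq (A.1 1 0 * z + A.1 1 1))⁻¹) ^ 3 *
      (1 + Complex.normSq z) := by
  have hq := auxQpos _ _ _ _ z (auxDetA A)
  have hp : 0 < 1 + Complex.normSq z := by
    have := Complex.normSq_nonneg z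
    linarith
  rw [jac_eval, pow32 (div_pos hp hq)]
  field_simp

lemma intP (A : SL2C) : ∫ z : ℂ,
    ((Complex.normSq (A.1 0 0 * z + A.1 0 1) + Complex.normSq (A.1 1 0 * z + A.1 1 1))⁻¹) ^ 3 *
      (1 + Complex.normSq z) = Real.pi * mVal A := by
  have h := auxDetA A
  unfold mVal
  generalize A.1 0 0 = a at *
  generalize A.1 0 1 = b at *
  generalize A.1 1 0 = c at *
  generalize A.1 1 1 = d at *
  have key := auxForm2 a b c d h (Complex.normSq d + Complex.normSq c)
    (Complex.normSq a + Complex.normSq b)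
    (-2 * (d.re * b.re + d.im * b.im + a.re * c.re + a.im * c.im))
    (2 * (d.im * b.re - d.re * b.im + c.im * a.re - c.re * a.im))
  rw [show Real.pi * ((Complex.normSq a + Complex.normSq b + Complex.normSq c
    + Complex.normSq d) / 2) = Real.pi * (Complex.normSq d + Complex.normSq c +
    (Complex.normSq a + Complex.normSq b)) / 2 by ring, ← key]
  congr 1
  ext z
  congr 1
  have e1 : z = d * (a * z + b) - b * (c * z + d) := by linear_combination -z * h
  have e2 : (1 : ℂ) = a * (c * z + d) - c * (a * z + b) := by linear_combination -h
  have e3 : 1 = Complex.normSq (a * (c * z + d) - c * (a * z + b)) := by rw [← e2]; simp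
  have e4 := congrArg Complex.normSq e1
  generalize a * z + b = X at *
  generalize c * z + d = Y at *
  rw [e4]
  nth_rw 1 [e3]
  simp only [Complex.normSq_apply, Complex.sub_re, Complex.sub_im, Complex.mul_re, Complex.mul_im]
  ring

/-- the value of mass times center of mass -/
noncomputable def vVal (A : SL2C) : Fin 3 → ℝ :=
  ![-((A.1 1 1).re * (A.1 1 0).re + (A.1 1 1).im * (A.1 1 0).im
      + (A.1 0 1).re * (A.1 0 0).re + (A.1 0 1).im * (A.1 0 0).im),
    -((A.1 1 1).im * (A.1 1 0).re - (A.1 1 1).re * (A.1 1 0).im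
      + (A.1 0 1).im * (A.1 0 0).re - (A.1 0 1).re * (A.1 0 0).im),
    (Complex.normSq (A.1 1 1) + Complex.normSq (A.1 0 1) - Complex.normSq (A.1 1 0)
      - Complex.normSq (A.1 0 0)) / 2]

lemma intV (A : SL2C) (i : Fin 3) : ∫ z : ℂ,
    ((Complex.normSq (A.1 0 0 * z + A.1 0 1) + Complex.normSq (A.1 1 0 * z + A.1 1 1))⁻¹) ^ 3 *
      (![2 * z.re, 2 * z.im, Complex.normSq z - 1] : Fin 3 → ℝ) i = Real.pi * vVal A i := by
  have h := auxDetA A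
  unfold vVal
  generalize A.1 0 0 = a at *
  generalize A.1 0 1 = b at *
  generalize A.1 1 0 = c at *
  generalize A.1 1 1 = d at *
  have e1 : ∀ z : ℂ, z = d * (a * z + b) - b * (c * z + d) := by
    intro z
    linear_combination -z * h
  have e2 : ∀ z : ℂ, (1 : ℂ) = a * (c * z + d) - c * (a * z + b) := by
    intro z
    linear_combination -h
  fin_cases i
  · have key := auxForm2 a b c d h (-2 * (d.re * c.re + d.im * c.im))
      (-2 * (b.re * a.re + b.im * a.im))
      (2 * (d.re * a.re + d.im * a.im) + 2 * (b.re * c.re + b.im * c.im))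
      (-2 * (d.im * a.re - d.re * a.im) + 2 * (b.im * c.re - b.re * c.im))
    refine Eq.trans ?_ (key.trans ?_)
    · congr 1
      ext z
      congr 1
      have f1 := congrArg Complex.re (e1 z)
      have f2 := congrArg Complex.im (e1 z)
      have f3 := congrArg Complex.re (e2 z)
      have f4 := congrArg Complex.im (e2 z)
      generalize a * z + b = X at *
      generalize c * z + d = Y at *
      have : 2 * z.re = 2 * (z.re * (1 : ℂ).re + z.im * (1 : ℂ).im) := by simp
      simp only [Fin.zero_eta, Matrix.cons_val]
      rw [this, f1, f2, f3, f4]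
      simp only [Complex.normSq_apply, Complex.sub_re, Complex.sub_im, Complex.mul_re,
        Complex.mul_im]
      ring
    · simp
      ring
  · have key := auxForm2 a b c d h (-2 * (d.im * c.re - d.re * c.im))
      (-2 * (b.im * a.re - b.re * a.im))
      (2 * (d.im * a.re - d.re * a.im) + 2 * (b.im * c.re - b.re * c.im))
      (2 * (d.re * a.re + d.im * a.im) - 2 * (b.re * c.re + b.im * c.im))
    refine Eq.trans ?_ (key.trans ?_)
    · congr 1
      ext z
      congr 1
      have f1 := congrArg Complex.re (e1 z)
      have f2 := congrArg Complex.im (e1 z)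
      have f3 := congrArg Complex.re (e2 z)
      have f4 := congrArg Complex.im (e2 z)
      generalize a * z + b = X at *
      generalize c * z + d = Y at *
      have : 2 * z.im = 2 * (z.im * (1 : ℂ).re - z.re * (1 : ℂ).im) := by simp
      simp only [Fin.mk_one, Matrix.cons_val]
      rw [this, f1, f2, f3, f4]
      simp only [Complex.normSq_apply, Complex.sub_re, Complex.sub_im, Complex.mul_re,
        Complex.mul_im]
      ring
    · simp
      ring
  · have key := auxForm2 a b c d h (Complex.normSq d - Complex.normSq c)
      (Complex.normSq b - Complex.normSq a)
      (-2 * (d.re * b.re + d.im * b.im) + 2 * (a.re * c.re + a.im * c.im))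
      (2 * (d.im * b.re - d.re * b.im) + 2 * (a.im * c.re - a.re * c.im))
    refine Eq.trans ?_ (key.trans ?_)
    · congr 1
      ext z
      congr 1
      have f1 := congrArg Complex.normSq (e1 z)
      have f3 := congrArg Complex.normSq (e2 z)
      generalize a * z + b = X at *
      generalize c * z + d = Y at *
      have : Complex.normSq z - 1 = Complex.normSq z - Complex.normSq 1 := by simp
      simp only [Fin.reduceFinMk, Matrix.cons_val]
      rw [this, f1, f3]
      simp only [Complex.normSq_apply, Complex.sub_re, Complex.sub_im, Complex.mul_re,
        Complex.mul_im]
      ring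
    · simp
      ring

lemma mass_eq (A : SL2C) : massA A = mVal A := by
  unfold massA
  rw [sphInt_eq]
  simp only [smul_eq_mul, integrand_eq]
  rw [intP]
  field_simp

lemma SPinv_eval (z : ℂ) (i : Fin 3) : (1 + Complex.normSq z) * SPinv (uncx z) i =
    (![2 * z.re, 2 * z.im, Complex.normSq z - 1] : Fin 3 → ℝ) i := by
  have hp : 0 < 1 + Complex.normSq z := by
    have := Complex.normSq_nonneg z
    linarith
  have e : sq2 (uncx z) = Complex.normSq z := by
    simp [sq2, uncx, Complex.normSq_apply, pow_two]
  fin_cases i <;> simp [SPinv, e] <;> field_simp <;> simp [uncx]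

lemma com_eq (A : SL2C) (i : Fin 3) : comA A i = vVal A i / mVal A := by
  have hm := mVal_pos A
  have hcont : Continuous fun z : ℂ => ((Complex.normSq (A.1 0 0 * z + A.1 0 1) +
      Complex.normSq (A.1 1 0 * z + A.1 1 1))⁻¹) ^ 3 := by
    refine Continuous.pow (Continuous.inv₀ ?_ ?_) 3
    · exact (Complex.continuous_normSq.comp (by fun_prop)).add
        (Complex.continuous_normSq.comp (by fun_prop))
    · intro z
      exact (auxQpos _ _ _ _ z (auxDetA A)).ne'
  have hI : Integrable fun z : ℂ => ((Complex.normSq (A.1 0 0 * z + A.1 0 1) +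
      Complex.normSq (A.1 1 0 * z + A.1 1 1))⁻¹) ^ 3 * (1 + Complex.normSq z) := by
    by_contra hn
    have h0 := integral_undef hn
    rw [intP] at h0
    have := Real.pi_pos
    have : 0 < Real.pi * mVal A := by positivity
    linarith
  have hIv : ∀ j : Fin 3, Integrable fun z : ℂ => ((Complex.normSq (A.1 0 0 * z + A.1 0 1) +
      Complex.normSq (A.1 1 0 * z + A.1 1 1))⁻¹) ^ 3 *
      (![2 * z.re, 2 * z.im, Complex.normSq z - 1] : Fin 3 → ℝ) j := by
    intro j
    refine hI.mono' ?_ (Filter.Eventually.of_forall fun z => ?_)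
    · apply Continuous.aestronglyMeasurable
      refine hcont.mul ?_
      have := Complex.continuous_re
      have := Complex.continuous_im
      have := Complex.continuous_normSq
      fin_cases j <;> simp <;> fun_prop
    · have hq := auxQpos _ _ _ _ z (auxDetA A)
      rw [norm_mul, Real.norm_eq_abs, Real.norm_eq_abs, abs_of_nonneg (by positivity)]
      gcongr
      rw [Complex.normSq_apply, abs_le]
      fin_cases j <;> simp <;> constructor <;>
        nlinarith [sq_nonneg (z.re - 1), sq_nonneg (z.re + 1), sq_nonneg z.im,
          sq_nonneg (z.im - 1), sq_nonneg (z.im + 1), sq_nonneg z.re]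
  unfold comA
  rw [sphInt_eq, mass_eq]
  have e : ∀ z : ℂ, ((1 + Complex.normSq z)⁻¹) ^ 2 • jacA A (SPinv (uncx z)) ^ (3 / 2 : ℝ) •
      SPinv (uncx z) = fun j => ((Complex.normSq (A.1 0 0 * z + A.1 0 1) +
      Complex.normSq (A.1 1 0 * z + A.1 1 1))⁻¹) ^ 3 *
      (![2 * z.re, 2 * z.im, Complex.normSq z - 1] : Fin 3 → ℝ) j := by
    intro z
    ext j
    rw [smul_smul, integrand_eq, ← SPinv_eval]
    simp only [Pi.smul_apply, smul_eq_mul]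
    ring
  simp only [e, Pi.smul_apply, smul_eq_mul]
  rw [eval_integral hIv, intV]
  field_simp

lemma norm_eq (A : SL2C) : 1 - norm3sq (comA A) = 1 / mVal A ^ 2 := by
  have hm := mVal_pos A
  have h := congrArg Complex.normSq (auxDetA A)
  have k : mVal A ^ 2 - (vVal A 0 ^ 2 + vVal A 1 ^ 2 + vVal A 2 ^ 2) = 1 := by
    rw [Complex.normSq_one] at h
    rw [← h]
    simp only [mVal, vVal, Matrix.cons_val, Complex.normSq_apply, Complex.sub_re, Complex.sub_im,
      Complex.mul_re, Complex.mul_im]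
    ring
  unfold norm3sq dot3
  simp only [com_eq]
  field_simp
  linarith

lemma dot_eq (A : SL2C) (z : ℂ) : 1 - dot3 (comA A) (SPinv (uncx z)) =
    (Complex.normSq (A.1 0 0 * z + A.1 0 1) + Complex.normSq (A.1 1 0 * z + A.1 1 1)) /
      (mVal A * (1 + Complex.normSq z)) := by
  have hm := mVal_pos A
  have hp : 0 < 1 + Complex.normSq z := by
    have := Complex.normSq_nonneg z
    linarith
  have s0 := SPinv_eval z 0
  have s1 := SPinv_eval z 1
  have s2 := SPinv_eval z 2
  simp only [Matrix.cons_val] at s0 s1 s2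
  have k : mVal A * (1 + Complex.normSq z) - (vVal A 0 * (2 * z.re) + vVal A 1 * (2 * z.im)
      + vVal A 2 * (Complex.normSq z - 1)) = Complex.normSq (A.1 0 0 * z + A.1 0 1) +
      Complex.normSq (A.1 1 0 * z + A.1 1 1) := by
    simp only [mVal, vVal, Matrix.cons_val, Complex.normSq_apply, Complex.add_re, Complex.add_im,
      Complex.mul_re, Complex.mul_im]
    ring
  rw [← k, ← s0, ← s1, ← s2]
  unfold dot3
  simp only [com_eq]
  field_simp

lemma weight_eq (A : SL2C) (z : ℂ) :
    (1 - norm3sq (comA A)) / (1 - dot3 (comA A) (SPinv (uncx z))) =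
    (1 + Complex.normSq z) / (mVal A * (Complex.normSq (A.1 0 0 * z + A.1 0 1) +
      Complex.normSq (A.1 1 0 * z + A.1 1 1))) := by
  have hm := mVal_pos A
  have hp : 0 < 1 + Complex.normSq z := by
    have := Complex.normSq_nonneg z
    linarith
  have hq := auxQpos _ _ _ _ z (auxDetA A)
  rw [norm_eq, dot_eq]
  field_simp

lemma exp_psi (A : SL2C) (z : ℂ) : Real.exp (2 * psiA A (SPinv (uncx z))) =
    ((1 + Complex.normSq z) / (Complex.normSq (A.1 0 0 * z + A.1 0 1) +
      Complex.normSq (A.1 1 0 * z + A.1 1 1))) ^ 3 / mVal A := by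
  have hm := mVal_pos A
  have hp : 0 < 1 + Complex.normSq z := by
    have := Complex.normSq_nonneg z
    linarith
  have hq := auxQpos _ _ _ _ z (auxDetA A)
  unfold psiA cA
  rw [mass_eq, jac_eval, Real.log_pow]
  have ht := div_pos hp hq
  generalize (1 + Complex.normSq z) / (Complex.normSq (A.1 0 0 * z + A.1 0 1) +
      Complex.normSq (A.1 1 0 * z + A.1 1 1)) = t at *
  have e : 2 * (3 / 4 * (((2 : ℕ) : ℝ) * Real.log t) + -(1 / 2) * Real.log (mVal A)) =
      Real.log (t ^ 3 / mVal A) := by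
    rw [Real.log_div (by positivity) hm.ne', Real.log_pow]
    push_cast
    ring
  rw [e, Real.exp_log (by positivity)]

lemma transform_gen {E : Type*} [NormedAddCommGroup E] [NormedSpace ℝ E]
    (A : SL2C) (u : (Fin 3 → ℝ) → ℝ) (F : (Fin 3 → ℝ) → E) :
    (sphInt fun ω => Real.exp (2 * (u (tauA A ω) + psiA A ω)) • F ω)
        = (sphInt fun ω =>
            ((1 - norm3sq (comA A)) / (1 - dot3 (comA A) (tauA A⁻¹ ω)) *
              Real.exp (2 * u ω)) • F (tauA A⁻¹ ω)) := by
  rw [sphInt_eq, sphInt_eq]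
  congr 1
  have h := auxDetA A
  rw [changeVar (A.1 0 0) (A.1 0 1) (A.1 1 0) (A.1 1 1) h
    (fun y => ((1 - norm3sq (comA A)) / (1 - dot3 (comA A) (tauA A⁻¹ (SPinv (uncx y)))) *
              Real.exp (2 * u (SPinv (uncx y)))) • F (tauA A⁻¹ (SPinv (uncx y))))]
  apply integral_congr_ae
  have hS0 : ∀ᵐ z : ℂ, A.1 1 0 * z + A.1 1 1 ≠ 0 := auxZeros _ _ _ _ h
  filter_upwards [hS0] with z hz
  rw [tau_inv_eval A z hz, tau_eval A z hz, weight_eq, mul_add, Real.exp_add, exp_psi,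
    smul_smul, smul_smul]
  congr 1
  have hm := mVal_pos A
  have hp : 0 < 1 + Complex.normSq z := by
    have := Complex.normSq_nonneg z
    linarith
  have hq := auxQpos _ _ _ _ z h
  field_simp

/-- transformation of the mass and center of mass of `e^{2u}` under
`u ↦ u_τ = u∘τ + ψ_τ`. -/
theorem exp_integral_transform (A : SL2C) (u : (Fin 3 → ℝ) → ℝ) (hu : Measurable u)
    (hint : SphIntegrable fun ω => Real.exp (2 * u ω)) :
    (sphInt fun ω => Real.exp (2 * (u (tauA A ω) + psiA A ω)))
        = (sphInt fun ω =>
            (1 - norm3sq (comA A)) / (1 - dot3 (comA A) (tauA A⁻¹ ω)) *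
              Real.exp (2 * u ω)) ∧
    (sphInt fun ω => Real.exp (2 * (u (tauA A ω) + psiA A ω)) • ω)
        = (sphInt fun ω =>
            ((1 - norm3sq (comA A)) / (1 - dot3 (comA A) (tauA A⁻¹ ω)) *
              Real.exp (2 * u ω)) • tauA A⁻¹ ω) := by
  refine ⟨?_, transform_gen A u (fun ω => ω)⟩
  have h := transform_gen A u (fun _ => (1 : ℝ))
  simpa only [smul_eq_mul, mul_one] using h
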